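/- Let u ∈ L^∞(ℝ^d; ℝ^d), let x₀ ∈ ℝ^d, and let (u⁺, u⁻, ν) ∈ ℝ^d × ℝ^d × S^{d−1} be such that u admits the blow-up v(z) = u⁺ 1_{⟨z,ν⟩ ≥ 0}(z) + u⁻ 1_{⟨z,ν⟩ < 0}(z) at x₀ (the case u⁺ = u⁻ is allowed). Let ρ ∈ K be a radial convolution kernel. Then for every y ∈ B₁ one has lim_{ℓ→0⁺} ∫_{B₁} u(x₀ + ℓ(y − z)) ρ(z) dz = α_ν(y) u⁺ + (1 − α_ν(y)) u⁻, where α_ν(y) := ∫_{B₁(y) ∩ {⟨z,ν⟩ ≥ 0}} ρ(y − z) dz and B₁(y) is the unit ball centered at y. -/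

import Mathlib

open MeasureTheory Filter Metric Set
open scoped Topology RealInnerProductSpace

noncomputable section

/-- The class `K` of admissible convolution kernels: smooth, compactly supported in the open
unit ball, even, with unit mass. -/
structure IsKernel (d : ℕ) (ρ : EuclideanSpace ℝ (Fin d) → ℝ) : Prop where
  smooth : ContDiff ℝ (⊤ : ℕ∞) ρ
  supp : tsupport ρ ⊆ Metric.ball 0 1
  even : ∀ z, ρ (-z) = ρ z
  mass : (∫ z, ρ z) = 1

/-- `u` admits the blow-up `v` at `x₀`:
`∫_{B₁} ‖u (x₀ + ℓ z) - v z‖ dz → 0` as `ℓ → 0⁺`. -/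
def HasBlowUp {d : ℕ} {F : Type*} [NormedAddCommGroup F]
    (u : EuclideanSpace ℝ (Fin d) → F) (x₀ : EuclideanSpace ℝ (Fin d))
    (v : EuclideanSpace ℝ (Fin d) → F) : Prop :=
  Filter.Tendsto (fun ℓ : ℝ => ∫ z in Metric.ball (0 : EuclideanSpace ℝ (Fin d)) 1,
      ‖u (x₀ + ℓ • z) - v z‖) (𝓝[>] (0:ℝ)) (𝓝 0)

/-- The mollification `(u ∗ ρ_ℓ)(x) = ∫ ρ_ℓ(y) u (x - y) dy`, with
`ρ_ℓ(y) = ℓ^{-d} ρ(y/ℓ)`. -/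
noncomputable def mollify {d : ℕ} {F : Type*} [NormedAddCommGroup F] [NormedSpace ℝ F]
    [CompleteSpace F]
    (ρ : EuclideanSpace ℝ (Fin d) → ℝ) (u : EuclideanSpace ℝ (Fin d) → F) (ℓ : ℝ)
    (x : EuclideanSpace ℝ (Fin d)) : F :=
  ∫ y, ((ℓ ^ d)⁻¹ * ρ (ℓ⁻¹ • y)) • u (x - y)

/-- The jump blow-up profile `v(z) = u⁺ 1_{⟨z,ν⟩ ≥ 0}(z) + u⁻ 1_{⟨z,ν⟩ < 0}(z)`. -/
def jumpFn {d : ℕ} {F : Type*} (up um : F) (ν : EuclideanSpace ℝ (Fin d)) :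
    EuclideanSpace ℝ (Fin d) → F :=
  fun z => if 0 ≤ ⟪z, ν⟫ then up else um

/-- `α_ν(y) = ∫_{B₁(y) ∩ {⟨z,ν⟩ ≥ 0}} ρ(y - z) dz`. -/
noncomputable def alphaNu {d : ℕ} (ρ : EuclideanSpace ℝ (Fin d) → ℝ)
    (ν : EuclideanSpace ℝ (Fin d)) (y : EuclideanSpace ℝ (Fin d)) : ℝ :=
  ∫ z in Metric.ball y 1 ∩ {z | 0 ≤ ⟪z, ν⟫}, ρ (y - z)

namespace IsKernel

variable {d : ℕ} {ρ : EuclideanSpace ℝ (Fin d) → ℝ}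

theorem eq_zero_of_notMem_ball (hρ : IsKernel d ρ) {z : EuclideanSpace ℝ (Fin d)}
    (hz : z ∉ Metric.ball (0 : EuclideanSpace ℝ (Fin d)) 1) : ρ z = 0 :=
  image_eq_zero_of_notMem_tsupport fun h => hz (hρ.supp h)

theorem hasCompactSupport (hρ : IsKernel d ρ) : HasCompactSupport ρ :=
  HasCompactSupport.intro (isCompact_closedBall (0 : EuclideanSpace ℝ (Fin d)) 1) fun _ hz =>
    hρ.eq_zero_of_notMem_ball fun h => hz (Metric.ball_subset_closedBall h)

theorem integrable (hρ : IsKernel d ρ) : Integrable ρ :=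
  hρ.smooth.continuous.integrable_of_hasCompactSupport hρ.hasCompactSupport

theorem integrable_smul_of_bounded {F : Type*} [NormedAddCommGroup F] [NormedSpace ℝ F]
    (hρ : IsKernel d ρ) (y : EuclideanSpace ℝ (Fin d)) {f : EuclideanSpace ℝ (Fin d) → F}
    (hf : StronglyMeasurable f) {C : ℝ} (hC : ∀ x, ‖f x‖ ≤ C) :
    Integrable fun w => ρ (y - w) • f w :=
  (hρ.integrable.comp_sub_left y).smul_bdd C hf.aestronglyMeasurable (ae_of_all _ hC)

end IsKernel

/-- If the blow-up `v` of `u` at `x₀` is invariant under dilation by two, then for `y` in the unit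
ball the integrals of `u (x₀ + ℓ w)` against the kernel `ρ (y - w)` converge to that of `v`. -/
theorem HasBlowUp.tendsto_integral_kernel_smul {d : ℕ} {F : Type*} [NormedAddCommGroup F]
    [NormedSpace ℝ F] {u v : EuclideanSpace ℝ (Fin d) → F} {x₀ : EuclideanSpace ℝ (Fin d)}
    (h : HasBlowUp u x₀ v) (hu : StronglyMeasurable u) (hv : StronglyMeasurable v)
    {Cu Cv : ℝ} (hCu : ∀ x, ‖u x‖ ≤ Cu) (hCv : ∀ x, ‖v x‖ ≤ Cv)
    (hhom : ∀ x, v ((2 : ℝ) • x) = v x)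
    {ρ : EuclideanSpace ℝ (Fin d) → ℝ} (hρ : IsKernel d ρ)
    {y : EuclideanSpace ℝ (Fin d)} (hy : y ∈ Metric.ball (0 : EuclideanSpace ℝ (Fin d)) 1) :
    Tendsto (fun ℓ : ℝ => ∫ w, ρ (y - w) • u (x₀ + ℓ • w)) (𝓝[>] (0:ℝ))
      (𝓝 (∫ w, ρ (y - w) • v w)) := by
  obtain ⟨M, hM⟩ := hρ.smooth.continuous.bounded_above_of_compact_support hρ.hasCompactSupport
  have hscale : Tendsto (fun ℓ : ℝ => ℓ * 2) (𝓝[>] (0:ℝ)) (𝓝[>] (0:ℝ)) := by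
    refine tendsto_nhdsWithin_iff.2 ⟨?_, ?_⟩
    · have : Tendsto (fun ℓ : ℝ => ℓ * 2) (𝓝 0) (𝓝 (0 * 2)) := tendsto_id.mul_const 2
      rw [zero_mul] at this
      exact this.mono_left nhdsWithin_le_nhds
    · filter_upwards [self_mem_nhdsWithin] with ℓ hℓ
      exact mul_pos (mem_Ioi.1 hℓ) two_pos
  have hlim := ((h.comp hscale).const_mul M).const_mul ((2 : ℝ) ^ d)
  simp only [mul_zero] at hlim
  rw [tendsto_iff_norm_sub_tendsto_zero]
  refine squeeze_zero (fun _ => norm_nonneg _) (fun ℓ => ?_) hlim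
  have hmeas (c : ℝ) : StronglyMeasurable fun w : EuclideanSpace ℝ (Fin d) => u (x₀ + c • w) :=
    hu.comp_measurable (by fun_prop)
  rw [← integral_sub (hρ.integrable_smul_of_bounded y (hmeas ℓ) fun _ => hCu _)
    (hρ.integrable_smul_of_bounded y hv hCv)]
  set G : EuclideanSpace ℝ (Fin d) → F :=
    fun w => ρ (y - w) • u (x₀ + ℓ • w) - ρ (y - w) • v w with hG
  have hcov : ∫ w, G w = (2 : ℝ) ^ d • ∫ x, G ((2 : ℝ) • x) := by
    rw [Measure.integral_comp_smul, finrank_euclideanSpace_fin, smul_smul,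
      abs_of_pos (by positivity), mul_inv_cancel₀ (by positivity), one_smul]
  rw [hcov, norm_smul, Real.norm_of_nonneg (by positivity)]
  refine mul_le_mul_of_nonneg_left ?_ (by positivity)
  simp only [Function.comp_apply]
  rw [← integral_const_mul]
  have hball : ∫ x, G ((2 : ℝ) • x) =
      ∫ x in Metric.ball (0 : EuclideanSpace ℝ (Fin d)) 1, G ((2 : ℝ) • x) := by
    refine (setIntegral_eq_integral_of_forall_compl_eq_zero fun x hx => ?_).symm
    have hzero : ρ (y - (2 : ℝ) • x) = 0 := by
      refine hρ.eq_zero_of_notMem_ball fun hmem => hx ?_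
      rw [mem_ball_zero_iff] at hmem hy ⊢
      have htri := norm_sub_norm_le ((2 : ℝ) • x) y
      rw [norm_sub_rev, norm_smul, Real.norm_of_nonneg zero_le_two] at htri
      linarith
    simp [hG, hzero]
  rw [hball]
  refine norm_integral_le_of_norm_le ?_ (ae_of_all _ fun x => ?_)
  · have hbound : Integrable (fun x => u (x₀ + (ℓ * 2) • x) - v x)
        (volume.restrict (Metric.ball (0 : EuclideanSpace ℝ (Fin d)) 1)) :=
      Measure.integrableOn_of_bounded (M := Cu + Cv) measure_ball_lt_top.ne
        ((hmeas _).sub hv).aestronglyMeasurable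
        (ae_of_all _ fun x => (norm_sub_le _ _).trans (add_le_add (hCu _) (hCv _)))
    exact hbound.norm.const_mul M
  · simp only [hG]
    rw [← smul_sub, norm_smul, hhom, smul_smul]
    exact mul_le_mul_of_nonneg_right (hM _) (norm_nonneg _)

section jumpFn

variable {d : ℕ} {F : Type*}

theorem jumpFn_smul (up um : F) (ν : EuclideanSpace ℝ (Fin d)) {c : ℝ} (hc : 0 < c)
    (x : EuclideanSpace ℝ (Fin d)) : jumpFn up um ν (c • x) = jumpFn up um ν x := by
  simp only [jumpFn, real_inner_smul_left, mul_nonneg_iff_of_pos_left hc]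

theorem measurableSet_inner_nonneg (ν : EuclideanSpace ℝ (Fin d)) :
    MeasurableSet {z : EuclideanSpace ℝ (Fin d) | 0 ≤ ⟪z, ν⟫} :=
  (isClosed_le continuous_const (by fun_prop)).measurableSet

theorem stronglyMeasurable_jumpFn [TopologicalSpace F] (up um : F)
    (ν : EuclideanSpace ℝ (Fin d)) : StronglyMeasurable (jumpFn up um ν) :=
  StronglyMeasurable.ite (measurableSet_inner_nonneg ν) stronglyMeasurable_const
    stronglyMeasurable_const

theorem norm_jumpFn_le [NormedAddCommGroup F] (up um : F) (ν x : EuclideanSpace ℝ (Fin d)) :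
    ‖jumpFn up um ν x‖ ≤ max ‖up‖ ‖um‖ := by
  unfold jumpFn
  split_ifs
  exacts [le_max_left _ _, le_max_right _ _]

theorem IsKernel.alphaNu_eq_setIntegral {ρ : EuclideanSpace ℝ (Fin d) → ℝ}
    (hρ : IsKernel d ρ) (ν y : EuclideanSpace ℝ (Fin d)) :
    alphaNu ρ ν y = ∫ z in {z | 0 ≤ ⟪z, ν⟫}, ρ (y - z) := by
  refine (setIntegral_eq_of_subset_of_forall_sdiff_eq_zero (measurableSet_inner_nonneg ν)
    inter_subset_right fun z hz => hρ.eq_zero_of_notMem_ball fun hmem => hz.2 ⟨?_, hz.1⟩).symm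
  rwa [mem_ball_zero_iff, ← dist_eq_norm, dist_comm] at hmem

theorem IsKernel.integral_smul_jumpFn [NormedAddCommGroup F] [NormedSpace ℝ F] [CompleteSpace F]
    {ρ : EuclideanSpace ℝ (Fin d) → ℝ} (hρ : IsKernel d ρ) (up um : F)
    (ν y : EuclideanSpace ℝ (Fin d)) :
    ∫ w, ρ (y - w) • jumpFn up um ν w =
      alphaNu ρ ν y • up + (1 - alphaNu ρ ν y) • um := by
  have hS := measurableSet_inner_nonneg ν
  have hint : Integrable fun w => ρ (y - w) := hρ.integrable.comp_sub_left y
  have hcompl : 1 - alphaNu ρ ν y = ∫ w in {z | 0 ≤ ⟪z, ν⟫}ᶜ, ρ (y - w) := by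
    rw [hρ.alphaNu_eq_setIntegral, setIntegral_compl hS hint,
      integral_sub_left_eq_self ρ volume y, hρ.mass]
  rw [hcompl, hρ.alphaNu_eq_setIntegral, ← integral_smul_const, ← integral_smul_const,
    ← integral_add_compl hS (hρ.integrable_smul_of_bounded y (stronglyMeasurable_jumpFn up um ν)
      (norm_jumpFn_le up um ν))]
  congr 1
  · exact setIntegral_congr_fun hS fun w hw => by simp only [jumpFn, if_pos hw.out]
  · exact setIntegral_congr_fun hS.compl fun w hw => by
      have hneg : ¬ 0 ≤ ⟪w, ν⟫ := hw
      simp only [jumpFn, if_neg hneg]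

end jumpFn

/-- If `u ∈ L^∞` admits at `x₀` the jump blow-up with data `(u⁺, u⁻, ν)` (with `u⁺ = u⁻`
allowed), and `ρ ∈ K` is radial, then for every `y ∈ B₁`,
`∫_{B₁} u(x₀ + ℓ(y - z)) ρ(z) dz → α_ν(y) u⁺ + (1 - α_ν(y)) u⁻` as `ℓ → 0⁺`. -/
theorem statement5 {d : ℕ} (u : EuclideanSpace ℝ (Fin d) → EuclideanSpace ℝ (Fin d))
    (hmeas : Measurable u) (hbd : ∃ C, ∀ x, ‖u x‖ ≤ C)
    (x₀ : EuclideanSpace ℝ (Fin d))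
    (up um : EuclideanSpace ℝ (Fin d)) (ν : EuclideanSpace ℝ (Fin d)) (hν : ‖ν‖ = 1)
    (hblow : HasBlowUp u x₀ (jumpFn up um ν))
    (ρ : EuclideanSpace ℝ (Fin d) → ℝ) (hρ : IsKernel d ρ)
    (hrad : ∃ g : ℝ → ℝ, ∀ z, ρ z = g ‖z‖)
    (y : EuclideanSpace ℝ (Fin d)) (hy : y ∈ Metric.ball (0 : EuclideanSpace ℝ (Fin d)) 1) :
    Tendsto (fun ℓ : ℝ =>
        ∫ z in Metric.ball (0 : EuclideanSpace ℝ (Fin d)) 1, ρ z • u (x₀ + ℓ • (y - z)))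
      (𝓝[>] (0:ℝ))
      (𝓝 (alphaNu ρ ν y • up + (1 - alphaNu ρ ν y) • um)) := by
  obtain ⟨C, hC⟩ := hbd
  rw [← hρ.integral_smul_jumpFn up um ν y]
  refine (hblow.tendsto_integral_kernel_smul hmeas.stronglyMeasurable
    (stronglyMeasurable_jumpFn up um ν) hC (norm_jumpFn_le up um ν)
    (jumpFn_smul up um ν two_pos) hρ hy).congr fun ℓ => ?_
  rw [setIntegral_eq_integral_of_forall_compl_eq_zero fun z hz => by
      rw [hρ.eq_zero_of_notMem_ball hz, zero_smul],
    ← integral_sub_left_eq_self (fun z => ρ z • u (x₀ + ℓ • (y - z))) volume y]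
  simp only [sub_sub_cancel]
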